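/- arXiv:1912.12648 — 4 statements merged into one kernel-verified Lean document; each statement's English description precedes it below -/
import Mathlib

section
/- Let v be an element of the algebraic closure of GF(p) with v + v^q ≠ 0, and set x = v^{q^2+1} / (v + v^q)^{q+1}. Then for every r ≥ 2, A_r(x) = (-1)^{r+1} · ( (Σ_{j=1}^{r} v^{q^j}) / (v^q + v^{q^2}) ) · Π_{j=2}^{r-1} ( v / (v + v^q) )^{q^j}, where the product over the empty index set (i.e., when r = 2) is taken to be 1. -/
open Polynomial

noncomputable abbrev Kbar (p : ℕ) [Fact p.Prime] : Type := AlgebraicClosure (ZMod p)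

noncomputable def A (q : ℕ) (K : Type) [Field K] : ℕ → Polynomial K
  | 0 => 0
  | 1 => 1
  | 2 => -1
  | (r+3) => -(A q K (r+2))^q - X^q * (A q K (r+1))^(q^2)


/-- A sequence satisfying a second-order recurrence twisted by a field endomorphism `φ`, in closed
form along a `φ`-orbit `u`. -/
theorem twisted_recurrence_closed_form {K : Type*} [Field K] (φ : K →+* K) (u a : ℕ → K) (x : K)
    (hu : ∀ j, φ (u j) = u (j + 1)) (hd : u 0 + u 1 ≠ 0)
    (hx : x = u 2 * u 0 / ((u 1 + u 2) * (u 0 + u 1)))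
    (h1 : a 1 = 1) (h2 : a 2 = -1)
    (ha : ∀ r, a (r + 3) = -φ (a (r + 2)) - φ x * φ (φ (a (r + 1)))) (n : ℕ) :
    a (n + 2) = (-1) ^ (n + 3) * ((∑ i ∈ Finset.range (n + 2), u (i + 1)) / (u 1 + u 2)) *
      ∏ i ∈ Finset.range n, (u (i + 2) / (u (i + 2) + u (i + 3))) := by
  have hd1 : u 1 + u 2 ≠ 0 := by
    simpa [hu] using (map_ne_zero φ).2 hd
  have hd2 : u 2 + u 3 ≠ 0 := by
    simpa [hu] using (map_ne_zero φ).2 hd1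
  have hd3 : u 3 + u 4 ≠ 0 := by
    simpa [hu] using (map_ne_zero φ).2 hd2
  have hφx : φ x = u 3 * u 1 / ((u 2 + u 3) * (u 1 + u 2)) := by
    simp [hx, hu]
  induction n using Nat.twoStepInduction with
  | zero =>
    simp only [Finset.sum_range_succ, Finset.sum_range_zero, Finset.prod_range_zero, zero_add, h2,
      Nat.reduceAdd]
    rw [div_self hd1]
    norm_num
  | one =>
    have h3 := ha 0
    simp only [zero_add, h1, h2, hφx, map_neg, map_one, neg_neg, mul_one] at h3
    simp only [Finset.sum_range_succ, Finset.sum_range_zero, Finset.prod_range_one, zero_add,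
      Nat.reduceAdd, h3]
    field_simp
    ring
  | more n ih0 ih1 =>
    rw [ha (n + 1), ih1, show n + 1 + 1 = n + 2 from rfl, ih0, hφx]
    simp only [map_mul, map_div₀, map_pow, map_neg, map_one, map_add, map_sum, map_prod, hu,
      Nat.reduceAdd]
    rw [Finset.sum_range_succ' (fun i => u (i + 1)) (n + 2 + 1),
      Finset.sum_range_succ' (fun i => u (i + 1 + 1)) (n + 2),
      Finset.prod_range_succ' _ (n + 1), Finset.prod_range_succ' _ n]
    simp only [add_assoc, Nat.reduceAdd, zero_add]
    generalize ∑ i ∈ Finset.range (n + 2), u (i + 3) = S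
    generalize ∏ i ∈ Finset.range n, (u (i + 4) / (u (i + 4) + u (i + 5))) = P
    field_simp
    ring

/-- If `v` is in the algebraic closure of GF(p) with `v + v^q ≠ 0` and
`x = v^{q^2+1}/(v+v^q)^{q+1}`, then for every `r ≥ 2`,
`A_r(x) = (-1)^{r+1}·((Σ_{j=1}^r v^{q^j})/(v^q+v^{q^2}))·Π_{j=2}^{r-1} (v/(v+v^q))^{q^j}`,
the product over the empty index set (`r = 2`) being `1`. -/
theorem statement_4 (p k q : ℕ) [Fact p.Prime] (hk : 0 < k) (hq : q = p ^ k)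
    (v : Kbar p) (hv : v + v ^ q ≠ 0)
    (x : Kbar p) (hx : x = v ^ (q ^ 2 + 1) / (v + v ^ q) ^ (q + 1))
    (r : ℕ) (hr : 2 ≤ r) :
    (A q (Kbar p) r).eval x
      = (-1) ^ (r + 1) * ((∑ j ∈ Finset.Icc 1 r, v ^ q ^ j) / (v ^ q + v ^ q ^ 2))
          * ∏ j ∈ Finset.Icc 2 (r - 1), (v / (v + v ^ q)) ^ q ^ j := by
  subst hq
  obtain ⟨n, rfl⟩ := Nat.exists_eq_add_of_le' hr
  have hu (m j : ℕ) (y : Kbar p) : (y ^ (p ^ k) ^ j) ^ (p ^ k) ^ m = y ^ (p ^ k) ^ (j + m) := by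
    rw [← pow_mul, ← pow_add]
  have hφ (y : Kbar p) : iterateFrobenius (Kbar p) p k y = y ^ p ^ k :=
    iterateFrobenius_def p k y
  have hadd (j : ℕ) : (v + v ^ p ^ k) ^ (p ^ k) ^ j = v ^ (p ^ k) ^ j + v ^ (p ^ k) ^ (j + 1) := by
    rw [← pow_mul p k j, add_pow_expChar_pow, pow_mul, ← pow_mul v, ← pow_succ']
  have key := twisted_recurrence_closed_form (iterateFrobenius (Kbar p) p k)
    (fun j => v ^ (p ^ k) ^ j) (fun r => (A (p ^ k) (Kbar p) r).eval x) x
    (fun j => by simpa [hφ] using hu 1 j v) (by simpa using hv)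
    (by
      have h := hadd 1
      rw [pow_one] at h
      simp only [hx, pow_succ _ (p ^ k), pow_succ _ ((p ^ k) ^ 2), h, pow_zero, pow_one])
    (by simp [A]) (by simp [A])
    (fun r => by simp [A, hφ, ← pow_mul, sq]) n
  have hIcc (m c : ℕ) (hc : 0 < c) : Finset.Icc c (m + c - 1) = Finset.Ico c (m + c) := by
    ext j
    simp only [Finset.mem_Icc, Finset.mem_Ico]
    omega
  have hsum : Finset.Icc 1 (n + 2) = Finset.Ico 1 (n + 2 + 1) := hIcc (n + 2) 1 one_pos
  rw [hsum, hIcc n 2 two_pos, Finset.sum_Ico_eq_sum_range, Finset.prod_Ico_eq_prod_range]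
  simpa [div_pow, hadd, add_comm, add_left_comm, add_assoc] using key
end

section
/- For any x in the algebraic closure of GF(p) with x^{q^m} = x (i.e., x ∈ GF(q^m)), one has G(x) = -x^q·F(x)^{q^2} + F(x)^q + x·F(x). -/
open Polynomial

section TwistedContinuant

variable {R : Type*} [CommRing R] (f : R →+* R) (x : R) {a : ℕ → R}

/-- A sequence satisfying the recursion twisted by the endomorphism `f` also satisfies
a recursion in which only the coefficient `x` is twisted. -/
lemma twisted_recursion (h0 : a 0 = 0) (h1 : a 1 = 1)
    (h : ∀ r, a (r + 2) = -f (a (r + 1)) - f x * f (f (a r))) (r : ℕ) :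
    a (r + 2) = -a (r + 1) - f^[r] x * a r := by
  have h2 : a 2 = -1 := by simp [h 0, h0, h1]
  induction r using Nat.twoStepInduction with
  | zero => simp [h0, h1, h2]
  | one => simp [h 1, h1, h2]
  | more r ih0 ih1 =>
    have e1 := congrArg f ih1
    have e0 := congrArg (fun y => f (f y)) ih0
    simp only [map_sub, map_neg, map_mul, ← Function.iterate_succ_apply' f] at e0 e1
    linear_combination h (r + 2) - e1 - f x * e0 + h (r + 1) + f^[r + 2] x * h r

/-- The identity between consecutive terms of a twisted recursion when `x` is fixed by the
`(m + 1)`-st iterate of `f`. -/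
lemma twisted_recursion_identity (h0 : a 0 = 0) (h1 : a 1 = 1)
    (h : ∀ r, a (r + 2) = -f (a (r + 1)) - f x * f (f (a r))) {m : ℕ}
    (hx : f^[m + 1] x = x) :
    -a (m + 2) - x * f (a m)
      = -f x * f (f (a (m + 1))) + f (a (m + 1)) + x * a (m + 1) := by
  cases m with
  | zero =>
    have hfx : f x = x := hx
    simp [h 0, h0, h1, hfx]
  | succ r =>
    have e := congrArg (fun y => f (f y)) (twisted_recursion f x h0 h1 h r)
    simp only [map_sub, map_neg, map_mul, ← Function.iterate_succ_apply' f] at e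
    rw [hx] at e
    linear_combination -h (r + 1) + f x * e - x * h r

end TwistedContinuant

lemma eval_A_add_two {K : Type} [Field K] (p k : ℕ) [ExpChar K p] (x : K) (r : ℕ) :
    (A (p ^ k) K (r + 2)).eval x = -iterateFrobenius K p k ((A (p ^ k) K (r + 1)).eval x)
      - iterateFrobenius K p k x *
        iterateFrobenius K p k (iterateFrobenius K p k ((A (p ^ k) K r).eval x)) := by
  cases r with
  | zero => simp [A]
  | succ r => simp [A, iterateFrobenius_def, ← pow_mul, sq]

/-- For any `x` in the algebraic closure of GF(p) with `x^{q^m} = x`,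
`G(x) = -x^q·F(x)^{q²} + F(x)^q + x·F(x)`, where `F(x) = A_m(x)`,
`G(x) = -A_{m+1}(x) - x·A_{m-1}(x)^q`, `q = p^k`, `d = gcd(n,k)`, `m = n/d`. -/
theorem statement_9 (p k n d m q : ℕ) [Fact p.Prime] (hk : 0 < k) (hn : 0 < n)
    (hd : d = Nat.gcd n k) (hm : m = n / d) (hq : q = p ^ k)
    (x : Kbar p) (hx : x ^ q ^ m = x) :
    -(A q (Kbar p) (m + 1)).eval x - x * ((A q (Kbar p) (m - 1)).eval x) ^ q
      = -x ^ q * ((A q (Kbar p) m).eval x) ^ q ^ 2 + ((A q (Kbar p) m).eval x) ^ q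
        + x * (A q (Kbar p) m).eval x := by
  subst hq
  let f := iterateFrobenius (Kbar p) p k
  have hm0 : 0 < m := by
    rw [hm, hd]
    exact Nat.div_pos (Nat.gcd_le_left k hn) (Nat.gcd_pos_of_pos_left k hn)
  obtain ⟨s, rfl⟩ := Nat.exists_eq_add_one.mpr hm0
  have hf : ∀ y, f y = y ^ p ^ k := iterateFrobenius_def p k
  have hfx : f^[s + 1] x = x := by
    rw [show ⇑f = (· ^ p ^ k) from funext hf, pow_iterate]
    exact hx
  have key := twisted_recursion_identity f x (a := fun r => (A (p ^ k) (Kbar p) r).eval x)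
    (by simp [A]) (by simp [A]) (eval_A_add_two p k x) hfx
  simpa [hf, ← pow_mul, sq] using key
end

section
/- Suppose p is odd. Let a ∈ GF(Q) be nonzero and set E = G(a)^2 - 4·a·F(a)^{q+1}. Then P_a(X) = X^{q+1} + X + a has exactly one zero in GF(Q) if and only if F(a) ≠ 0 and E = 0; and in this case the unique zero of P_a in GF(Q) is -G(a)/(2·F(a)). -/
open Polynomial

/-- The values at `a` of the polynomials `A`, for an arbitrary endomorphism `σ` in place of the
`q`-power map. -/
def twistedSeq {K : Type*} [Field K] (σ : K →+* K) (a : K) : ℕ → K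
  | 0 => 0
  | 1 => 1
  | r + 2 => -σ (twistedSeq σ a (r + 1)) - σ a * σ (σ (twistedSeq σ a r))

section
variable {K : Type*} [Field K] {σ : K →+* K} {a : K}

theorem twistedSeq_zero : twistedSeq σ a 0 = 0 := by rw [twistedSeq]
theorem twistedSeq_one : twistedSeq σ a 1 = 1 := by rw [twistedSeq]
theorem twistedSeq_add_two (r : ℕ) : twistedSeq σ a (r + 2) =
    -σ (twistedSeq σ a (r + 1)) - σ a * σ (σ (twistedSeq σ a r)) := by rw [twistedSeq]

theorem ringHom_pow_succ_apply (σ : K →+* K) (r : ℕ) (x : K) : (σ ^ (r + 1)) x = σ ((σ ^ r) x) := by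
  rw [pow_succ']; rfl

theorem twistedSeq_add_two' (r : ℕ) : twistedSeq σ a (r + 2) =
    -twistedSeq σ a (r + 1) - (σ ^ r) a * twistedSeq σ a r := by
  induction r using Nat.twoStepInduction with
  | zero => simp [twistedSeq_add_two, twistedSeq_zero, twistedSeq_one]
  | one => simp [twistedSeq_add_two, twistedSeq_zero, twistedSeq_one]
  | more r h1 h2 =>
    have e1 := congrArg σ h2
    have e2 := congrArg (fun t => σ (σ t)) h1
    simp only [map_sub, map_neg, map_mul] at e1 e2
    have e3 := twistedSeq_add_two (σ := σ) (a := a) r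
    have e4 := twistedSeq_add_two (σ := σ) (a := a) (r + 1)
    rw [twistedSeq_add_two (r + 2)]
    simp only [ringHom_pow_succ_apply] at *
    linear_combination -e1 - σ a * e2 + e4 + σ (σ ((σ ^ r) a)) * e3

theorem twisted_relations {s : ℕ} (hs : (σ ^ (s + 1)) a = a) {F G : K}
    (hF : F = twistedSeq σ a (s + 1))
    (hG : G = -twistedSeq σ a (s + 2) - a * σ (twistedSeq σ a s)) :
    G = a * F + σ F - σ a * σ (σ F) ∧ σ G = 2 * σ F - G := by
  have e1 := congrArg σ (twistedSeq_add_two' (σ := σ) (a := a) s)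
  have e2 := twistedSeq_add_two' (σ := σ) (a := a) (s + 1)
  have e3 := twistedSeq_add_two (σ := σ) (a := a) s
  have e4 := twistedSeq_add_two (σ := σ) (a := a) (s + 1)
  simp only [map_sub, map_neg, map_mul, ← ringHom_pow_succ_apply, hs] at e1
  rw [hs] at e2
  subst hF hG
  constructor
  · linear_combination e4 - e2 - e1
  · simp only [map_sub, map_neg, map_mul]
    linear_combination -e1 - e3

variable {x : K}

theorem twisted_zero_step (hx : x * σ x + x + a = 0) (r : ℕ) :
    twistedSeq σ a (r + 2) * x - a * σ (twistedSeq σ a (r + 1)) =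
      x * σ (twistedSeq σ a (r + 1) * x - a * σ (twistedSeq σ a r)) := by
  rw [twistedSeq_add_two]
  simp only [map_sub, map_mul]
  linear_combination -σ (twistedSeq σ a (r + 1)) * hx

theorem twisted_zero_step' (hx : x * σ x + x + a = 0) (r : ℕ) :
    twistedSeq σ a (r + 2) * x - a * σ (twistedSeq σ a (r + 1)) =
      (twistedSeq σ a (r + 1) * x - a * σ (twistedSeq σ a r)) * (σ ^ (r + 1)) x := by
  induction r with
  | zero => rw [twisted_zero_step hx]; simp [twistedSeq_zero, twistedSeq_one]
  | succ r ih =>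
    rw [twisted_zero_step hx (r + 1), ih, map_mul, ← ringHom_pow_succ_apply]
    linear_combination (σ ^ (r + 1 + 1)) x * (ih.symm.trans (twisted_zero_step hx r)).symm

theorem twisted_zero_ne_zero (hx : x * σ x + x + a = 0) (hx0 : x ≠ 0) (r : ℕ) :
    twistedSeq σ a (r + 1) * x - a * σ (twistedSeq σ a r) ≠ 0 := by
  induction r with
  | zero => simpa [twistedSeq_zero, twistedSeq_one]
  | succ r ih =>
    rw [twisted_zero_step hx]
    exact mul_ne_zero hx0 ((map_ne_zero σ).mpr ih)

/-- The orbit of `(t, 0)` under the semilinear map `x • M⁻¹ σ`, where `M = !![-1, -a; 1, 0]`. -/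
def twistedOrbit (σ : K →+* K) (a x t : K) : ℕ → K × K
  | 0 => (t, 0)
  | r + 1 => (x * σ (twistedOrbit σ a x t r).2,
      -(x / a) * (σ (twistedOrbit σ a x t r).1 + σ (twistedOrbit σ a x t r).2))

theorem twistedOrbit_functional (hx : x * σ x + x + a = 0) (ha : a ≠ 0) :
    ∃ c : ℕ → K, c 0 = 1 ∧ ∀ t r,
      (twistedOrbit σ a x t r).1 - x * (twistedOrbit σ a x t r).2 = c r * (σ ^ r) t := by
  refine ⟨fun r => Nat.rec 1 (fun _ c => x ^ 2 / a * σ c) r, rfl, fun t r => ?_⟩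
  induction r with
  | zero => simp [twistedOrbit]
  | succ r ih =>
    have e := congrArg σ ih
    simp only [map_sub, map_mul, ← ringHom_pow_succ_apply] at e
    simp only [twistedOrbit]
    rw [mul_assoc, ← e]
    field_simp
    linear_combination x * σ (twistedOrbit σ a x t r).2 * hx

theorem twistedOrbit_pow_apply (hx : x * σ x + x + a = 0) (ha : a ≠ 0) (t : K) (r : ℕ) :
    (twistedSeq σ a (r + 1) * x - a * σ (twistedSeq σ a r)) * (σ ^ (r + 1)) t =
      twistedSeq σ a (r + 2) * (twistedOrbit σ a x t (r + 1)).1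
        - a * σ (twistedSeq σ a (r + 1)) * (twistedOrbit σ a x t (r + 1)).2 ∧
    0 = twistedSeq σ a (r + 1) * (twistedOrbit σ a x t (r + 1)).1
        - a * σ (twistedSeq σ a r) * (twistedOrbit σ a x t (r + 1)).2 := by
  induction r with
  | zero =>
    simp [twistedOrbit, twistedSeq_zero, twistedSeq_one, twistedSeq_add_two]
    field_simp
  | succ r ih =>
    obtain ⟨e1, e2⟩ := ih
    replace e1 := congrArg σ e1
    replace e2 := congrArg σ e2
    rw [map_mul, ← ringHom_pow_succ_apply] at e1
    rw [twisted_zero_step hx, mul_assoc, e1]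
    rw [map_zero] at e2
    have h1 : (twistedOrbit σ a x t (r + 2)).1 = x * σ (twistedOrbit σ a x t (r + 1)).2 := rfl
    have h2 : a * (twistedOrbit σ a x t (r + 2)).2 = -x * (σ (twistedOrbit σ a x t (r + 1)).1
        + σ (twistedOrbit σ a x t (r + 1)).2) := by
      rw [twistedOrbit]; field_simp
    simp only [map_sub, map_mul] at e2 ⊢
    have h3 := twistedSeq_add_two (σ := σ) (a := a) r
    have h4 := twistedSeq_add_two (σ := σ) (a := a) (r + 1)
    constructor
    · rw [h1, h4]
      linear_combination σ (twistedSeq σ a (r + 1 + 1)) * h2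
    · rw [h1, h3]
      linear_combination σ (twistedSeq σ a (r + 1)) * h2 + x * e2

theorem twistedOrbit_periodic (hx : x * σ x + x + a = 0) (ha : a ≠ 0) (hx0 : x ≠ 0) {s : ℕ}
    (hs : σ ^ (s + 1) = 1) (hF : twistedSeq σ a (s + 1) = 0) (t : K) :
    twistedOrbit σ a x t (s + 1) = (t, 0) := by
  have h1 := twisted_zero_step' hx s
  obtain ⟨h2, h3⟩ := twistedOrbit_pow_apply hx ha t s
  obtain ⟨h4, -⟩ := twisted_relations (by rw [hs]; rfl) hF.symm rfl
  have hne := twisted_zero_ne_zero hx hx0 s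
  rw [hs] at h1 h2
  simp only [RingHom.one_def, RingHom.id_apply, hF, map_zero, mul_zero, sub_zero, zero_mul,
    zero_sub, zero_add] at h1 h2 h3 h4 hne
  have h5 : twistedSeq σ a (s + 2) = -(a * σ (twistedSeq σ a s)) := mul_right_cancel₀ hx0 h1
  rw [h5] at h2
  have h6 := mul_left_cancel₀ hne h2
  have h7 : (twistedOrbit σ a x t (s + 1)).2 = 0 := by
    rcases mul_eq_zero.mp (neg_eq_zero.mp h3.symm) with h | h
    · exact absurd (by rw [h, neg_zero]) hne
    · exact h
  exact Prod.ext h6.symm h7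

theorem exists_sum_pow_ne_zero {s : ℕ} (hs : orderOf σ = s + 1) (c : ℕ → K) (hc : c 0 = 1) :
    ∃ t, ∑ i ∈ Finset.range (s + 1), c i * (σ ^ i) t ≠ 0 := by
  by_contra! h
  have hinj : Function.Injective (fun i : Fin (s + 1) => ((σ ^ (i : ℕ) : K →+* K) : K →* K)) := by
    intro i j hij
    have h1 : σ ^ (i : ℕ) = σ ^ (j : ℕ) := RingHom.ext fun y => DFunLike.congr_fun hij y
    exact Fin.ext (pow_injOn_Iio_orderOf (hs.symm ▸ i.2 : (i : ℕ) < orderOf σ)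
      (hs.symm ▸ j.2 : (j : ℕ) < orderOf σ) h1)
  have hli := (linearIndependent_monoidHom K K).comp _ hinj
  rw [Fintype.linearIndependent_iff] at hli
  have h0 := hli (fun i => c i) (by
    funext t
    simpa [Finset.sum_range] using h t) 0
  simp [hc] at h0

theorem exists_other_zero (hx : x * σ x + x + a = 0) (ha : a ≠ 0) (hx0 : x ≠ 0) {s : ℕ}
    (hs : orderOf σ = s + 1) (hF : twistedSeq σ a (s + 1) = 0) :
    ∃ y, y * σ y + y + a = 0 ∧ y ≠ x := by
  obtain ⟨c, hc, hcr⟩ := twistedOrbit_functional hx ha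
  obtain ⟨t, ht⟩ := exists_sum_pow_ne_zero hs c hc
  have hper := twistedOrbit_periodic hx ha hx0 (hs ▸ pow_orderOf_eq_one σ) hF t
  simp only [← hcr t, Finset.sum_sub_distrib, ← Finset.mul_sum] at ht
  set W := fun i => twistedOrbit σ a x t i with hW
  have hsh : ∀ φ : K × K → K, ∑ i ∈ Finset.range (s + 1), φ (W (i + 1)) =
      ∑ i ∈ Finset.range (s + 1), φ (W i) := by
    intro φ
    rw [Finset.sum_range_succ, Finset.sum_range_succ', hW]
    exact congrArg _ (congrArg φ hper)
  set U := ∑ i ∈ Finset.range (s + 1), (W i).1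
  set V := ∑ i ∈ Finset.range (s + 1), (W i).2
  have hU : U = x * σ V := by
    rw [map_sum, Finset.mul_sum]
    exact (hsh Prod.fst).symm
  have hV : V = -(x / a) * (σ U + σ V) := by
    rw [map_sum, map_sum, ← Finset.sum_add_distrib, Finset.mul_sum]
    exact (hsh Prod.snd).symm
  have hUV : U - x * V ≠ 0 := ht
  have hV0 : V ≠ 0 := by
    intro h
    rw [h, map_zero, mul_zero] at hU
    simp [h, hU] at hUV
  have hσV : σ V ≠ 0 := (map_ne_zero σ).mpr hV0
  refine ⟨U / V, ?_, fun h => hUV ?_⟩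
  · rw [map_div₀]
    field_simp at hV ⊢
    rw [hU] at *
    linear_combination σ V * hV
  · rw [← h]; field_simp; ring

theorem twisted_quadratic {s : ℕ} (hs : σ ^ (s + 1) = 1) {F G : K}
    (hF : F = twistedSeq σ a (s + 1))
    (hG : G = -twistedSeq σ a (s + 2) - a * σ (twistedSeq σ a s))
    (hx : x * σ x + x + a = 0) : F * x ^ 2 + G * x + a * σ F = 0 := by
  have h := twisted_zero_step' hx s
  rw [hs, RingHom.one_def, RingHom.id_apply, ← hF] at h
  rw [hG]
  linear_combination -h

theorem zeros_eq_singleton {s : ℕ} (h2 : (2 : K) ≠ 0) (hs : σ ^ (s + 1) = 1) {F G : K}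
    (hF : F = twistedSeq σ a (s + 1))
    (hG : G = -twistedSeq σ a (s + 2) - a * σ (twistedSeq σ a s))
    (hF0 : F ≠ 0) (hE : G ^ 2 - 4 * a * (F * σ F) = 0) :
    {x : K | x * σ x + x + a = 0} = {-G / (2 * F)} := by
  have hσF : σ F ≠ 0 := (map_ne_zero σ).mpr hF0
  obtain ⟨-, hσG⟩ := twisted_relations (by rw [hs]; rfl) hF hG
  ext x
  simp only [Set.mem_ofPred_eq, Set.mem_singleton_iff]
  constructor
  · intro hx
    have hq := twisted_quadratic hs hF hG hx
    have : (2 * F * x + G) ^ 2 = 0 := by linear_combination hE + 4 * F * hq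
    rw [eq_div_iff (by simp [h2, hF0])]
    linear_combination pow_eq_zero_iff (two_ne_zero) |>.mp this
  · rintro rfl
    rw [map_div₀, map_neg, map_mul, hσG, map_ofNat]
    have h4 : (4 : K) = 2 * 2 := by norm_num
    field_simp
    linear_combination -hE

theorem ncard_zeros_eq_one_iff {s : ℕ} (h2 : (2 : K) ≠ 0) (ha : a ≠ 0)
    (hs : orderOf σ = s + 1) {F G : K} (hF : F = twistedSeq σ a (s + 1))
    (hG : G = -twistedSeq σ a (s + 2) - a * σ (twistedSeq σ a s)) :
    {x : K | x * σ x + x + a = 0}.ncard = 1 ↔ F ≠ 0 ∧ G ^ 2 - 4 * a * (F * σ F) = 0 := by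
  have hs' : σ ^ (s + 1) = 1 := hs ▸ pow_orderOf_eq_one σ
  constructor
  · intro h
    obtain ⟨x, hxs⟩ := Set.ncard_eq_one.mp h
    have huniq : ∀ y, y * σ y + y + a = 0 ↔ y = x := fun y => by
      simpa using Set.ext_iff.mp hxs y
    have hx := (huniq x).mpr rfl
    have hx0 : x ≠ 0 := by
      rintro rfl
      simp [ha] at hx
    have hF0 : F ≠ 0 := by
      intro hF0
      obtain ⟨y, hy, hne⟩ := exists_other_zero hx ha hx0 hs (hF ▸ hF0)
      exact hne ((huniq y).mp hy)
    refine ⟨hF0, ?_⟩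
    have hσF : σ F ≠ 0 := (map_ne_zero σ).mpr hF0
    obtain ⟨-, hσG⟩ := twisted_relations (by rw [hs']; rfl) hF hG
    have hq := twisted_quadratic hs' hF hG hx
    have hy : -G / F - x = x := by
      refine (huniq _).mp ?_
      rw [map_sub, map_div₀, map_neg, hσG]
      have hT : x * ((G + F * x) * (σ F + σ F * σ x - G) + a * F * σ F) = 0 := by
        linear_combination (G + F * x) * σ F * hx - G * hq
      have hT := (mul_eq_zero.mp hT).resolve_left hx0
      field_simp
      linear_combination hT
    field_simp at hy
    have hy : G = -2 * F * x := by linear_combination -hy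
    rw [hy] at hq ⊢
    linear_combination -4 * F * hq
  · rintro ⟨hF0, hE⟩
    rw [zeros_eq_singleton h2 hs' hF hG hF0 hE, Set.ncard_singleton]
end

theorem orderOf_frobenius_galoisField (p n : ℕ) [Fact p.Prime] (hn : n ≠ 0) :
    orderOf (frobenius (GaloisField p n) p) = n := by
  have h1 := FiniteField.orderOf_frobeniusAlgHom (ZMod p) (GaloisField p n)
  rw [GaloisField.finrank p hn] at h1
  refine Eq.trans (orderOf_eq_orderOf_iff.mpr ?_) h1
  intro r
  simp only [DFunLike.ext_iff, RingHom.coe_pow, AlgHom.coe_pow, FiniteField.coe_frobeniusAlgHom,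
    ZMod.card]
  rfl

theorem orderOf_iterateFrobenius_galoisField (p n k : ℕ) [Fact p.Prime] (hn : n ≠ 0) (hk : k ≠ 0) :
    orderOf (iterateFrobenius (GaloisField p n) p k) = n / n.gcd k := by
  rw [iterateFrobenius_eq_pow, orderOf_pow' _ hk, orderOf_frobenius_galoisField p n hn]

theorem exists_galoisField_eq {p n : ℕ} [Fact p.Prime] (hn : n ≠ 0) {L : Type*} [Field L]
    [Algebra (ZMod p) L] (ι : GaloisField p n →ₐ[ZMod p] L) {x : L} :
    (∃ y, ι y = x) ↔ x ^ p ^ n = x := by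
  have hfix : ∀ y, ι y ^ p ^ n = ι y := fun y => by
    have : Fintype (GaloisField p n) := Fintype.ofFinite _
    rw [← map_pow, ← GaloisField.card p n hn, Nat.card_eq_fintype_card, FiniteField.pow_card]
  have h1p : 1 < p := Fact.out (p := p.Prime).one_lt
  have hne : (X ^ p ^ n - X : L[X]) ≠ 0 := FiniteField.X_pow_card_pow_sub_X_ne_zero _ hn h1p
  classical
  have hmem : ∀ z : L, z ∈ (X ^ p ^ n - X : L[X]).roots.toFinset ↔ z ^ p ^ n = z := fun z => by
    simp [hne, sub_eq_zero]
  have : Fintype (GaloisField p n) := Fintype.ofFinite _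
  have hinj : Function.Injective ι := RingHom.injective ι.toRingHom
  have himg : Finset.univ.image ι = (X ^ p ^ n - X : L[X]).roots.toFinset := by
    apply Finset.eq_of_subset_of_card_le
    · intro z hz
      obtain ⟨y, -, rfl⟩ := Finset.mem_image.mp hz
      exact (hmem _).mpr (hfix y)
    · rw [Finset.card_image_of_injective _ hinj, Finset.card_univ,
        ← Nat.card_eq_fintype_card, GaloisField.card p n hn]
      refine (Multiset.toFinset_card_le _).trans ((card_roots' _).trans ?_)
      rw [FiniteField.X_pow_card_pow_sub_X_natDegree_eq _ hn h1p]
  rw [← hmem, ← himg]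
  simp

theorem A_add_two {q : ℕ} (hq : q ≠ 0) (K : Type) [Field K] (r : ℕ) :
    A q K (r + 2) = -(A q K (r + 1)) ^ q - X ^ q * (A q K r) ^ (q ^ 2) := by
  cases r with
  | zero => simp [A, hq]
  | succ r => rw [A]

theorem eval_A {K : Type*} {L : Type} [Field K] [Field L] {q : ℕ} (hq : q ≠ 0) {σ : K →+* K}
    (hσ : ∀ x, σ x = x ^ q) (ι : K →+* L) (a : K) (r : ℕ) :
    (A q L r).eval (ι a) = ι (twistedSeq σ a r) := by
  induction r using Nat.twoStepInduction with
  | zero => simp [A, twistedSeq_zero]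
  | one => simp [A, twistedSeq_one]
  | more r h1 h2 => simp [A_add_two hq, twistedSeq_add_two, h1, h2, hσ, ← pow_mul, sq]


/-- `p` odd. For nonzero `a ∈ GF(Q)` and `E = G(a)² - 4·a·F(a)^{q+1}`:
`P_a(X) = X^{q+1} + X + a` has exactly one zero in `GF(Q)` iff `F(a) ≠ 0` and `E = 0`,
and in this case the unique zero is `-G(a)/(2·F(a))`.  Here `F(a) = A_m(a)`,
`G(a) = -A_{m+1}(a) - a·A_{m-1}(a)^q`, `q = p^k`, `Q = p^n`, `d = gcd(n,k)`, `m = n/d`. -/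
theorem statement_15 (p k n d m q Q : ℕ) [Fact p.Prime] (hp : Odd p) (hk : 0 < k) (hn : 0 < n)
    (hd : d = Nat.gcd n k) (hm : m = n / d) (hq : q = p ^ k) (hQ : Q = p ^ n)
    (a : Kbar p) (haQ : a ^ Q = a) (ha0 : a ≠ 0)
    (Fa Ga E : Kbar p)
    (hFa : Fa = (A q (Kbar p) m).eval a)
    (hGa : Ga = -(A q (Kbar p) (m + 1)).eval a - a * ((A q (Kbar p) (m - 1)).eval a) ^ q)
    (hE : E = Ga ^ 2 - 4 * a * Fa ^ (q + 1)) :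
    ({x : Kbar p | x ^ Q = x ∧ x ^ (q + 1) + x + a = 0}.ncard = 1 ↔ Fa ≠ 0 ∧ E = 0) ∧
    (Fa ≠ 0 → E = 0 →
      {x : Kbar p | x ^ Q = x ∧ x ^ (q + 1) + x + a = 0} = {-Ga / (2 * Fa)}) := by
  have hp2 : (2 : Kbar p) ≠ 0 := by
    have : CharP (Kbar p) p := charP_of_injective_algebraMap' (ZMod p) p
    exact Ring.two_ne_zero (by rw [ringChar.eq (Kbar p) p]; rintro rfl; exact absurd hp (by decide))
  have hq0 : q ≠ 0 := by rw [hq]; exact pow_ne_zero _ (Fact.out (p := p.Prime)).ne_zero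
  let ι : GaloisField p n →ₐ[ZMod p] Kbar p := IsAlgClosed.lift
  have hinj : Function.Injective ι := RingHom.injective ι.toRingHom
  have hfix : ∀ x, (∃ y, ι y = x) ↔ x ^ Q = x := fun x => hQ ▸ exists_galoisField_eq hn.ne' ι
  set σ := iterateFrobenius (GaloisField p n) p k
  have hσ : ∀ x, σ x = x ^ q := fun x => by rw [hq]; rfl
  obtain ⟨s, rfl⟩ : ∃ s, m = s + 1 := Nat.exists_eq_succ_of_ne_zero <| by
    rw [hm, hd]
    exact (Nat.div_pos (Nat.gcd_le_left k hn) (Nat.gcd_pos_of_pos_left k hn)).ne'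
  have hord : orderOf σ = s + 1 := by
    rw [hm, hd]
    exact orderOf_iterateFrobenius_galoisField p n k hn.ne' hk.ne'
  obtain ⟨b, rfl⟩ := (hfix a).mpr haQ
  have hA := eval_A hq0 hσ (ι : GaloisField p n →+* Kbar p) b
  simp only [RingHom.coe_coe] at hA
  set F := twistedSeq σ b (s + 1) with hF
  set G := -twistedSeq σ b (s + 2) - b * σ (twistedSeq σ b s) with hG
  have hFι : Fa = ι F := by rw [hFa, hA]
  have hGι : Ga = ι G := by
    rw [hGa, hA, Nat.add_sub_cancel, hA, hG, hσ]
    simp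
  have hEι : E = ι (G ^ 2 - 4 * b * (F * σ F)) := by
    rw [hE, hFι, hGι, hσ]
    simp [pow_succ', map_ofNat ι 4]
  have hset : {x : Kbar p | x ^ Q = x ∧ x ^ (q + 1) + x + ι b = 0} =
      ι '' {y | y * σ y + y + b = 0} := by
    ext x
    simp only [Set.mem_ofPred_eq, Set.mem_image, ← hfix]
    constructor
    · rintro ⟨⟨y, rfl⟩, h⟩
      refine ⟨y, hinj ?_, rfl⟩
      simpa [hσ, pow_succ'] using h
    · rintro ⟨y, h, rfl⟩
      refine ⟨⟨y, rfl⟩, ?_⟩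
      simpa [hσ, pow_succ'] using congrArg ι h
  have h2 : (2 : GaloisField p n) ≠ 0 := fun h => hp2 <| by
    rw [← map_ofNat ι 2, h, map_zero]
  have hF0 : Fa ≠ 0 ↔ F ≠ 0 := by rw [hFι, _root_.map_ne_zero]
  have hE0 : E = 0 ↔ G ^ 2 - 4 * b * (F * σ F) = 0 := by rw [hEι, map_eq_zero]
  rw [hset, Set.ncard_image_of_injective _ hinj, hF0, hE0]
  refine ⟨ncard_zeros_eq_one_iff h2 ((_root_.map_ne_zero ι).mp ha0) hord hF hG, fun h1 h3 => ?_⟩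
  rw [zeros_eq_singleton h2 (hord ▸ pow_orderOf_eq_one σ) hF hG h1 h3, Set.image_singleton,
    hFι, hGι]
  simp [map_ofNat ι 2]
end

section
/- Suppose p is odd. Let a ∈ GF(Q) be nonzero and set E = G(a)^2 - 4·a·F(a)^{q+1} (an element of GF(p^d)). Then P_a(X) = X^{q+1} + X + a has exactly two zeros in GF(Q) if and only if E is a nonzero square in GF(p^d), i.e., E^{(p^d - 1)/2} = 1; and in this case, for any s ∈ GF(p^d) with s^2 = E, the two zeros of P_a in GF(Q) are (s - G(a))/(2·F(a)) and (-s - G(a))/(2·F(a)). -/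
open Polynomial

/-- `B` satisfies the recurrence of the values `A_r(a)`, with the ring endomorphism `φ` in the
role of the `q`-power map. -/
structure IsTwistedSeq {R : Type*} [CommRing R] (φ : R →+* R) (a : R) (B : ℕ → R) : Prop where
  zero : B 0 = 0
  one : B 1 = 1
  add_two : ∀ r, B (r + 2) = -φ (B (r + 1)) - φ a * φ (φ (B r))

namespace IsTwistedSeq

section CommRing

variable {R : Type*} [CommRing R] {φ : R →+* R} {a : R} {B : ℕ → R}

theorem add_two' (h : IsTwistedSeq φ a B) (r : ℕ) :
    B (r + 2) = -B (r + 1) - φ^[r] a * B r := by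
  induction r using Nat.twoStepInduction with
  | zero => simp [h.add_two, h.zero, h.one]
  | one => simp [h.add_two, h.zero, h.one]
  | more r ih₁ ih₂ =>
    have e₁ := congrArg (fun x => φ (φ x)) ih₁
    have e₂ := congrArg φ ih₂
    simp only [map_sub, map_neg, map_mul, ← Function.iterate_succ_apply'] at e₁ e₂
    simp only [Function.iterate_succ_apply'] at e₁ e₂ ⊢
    rw [h.add_two (r + 2)]
    linear_combination -e₂ - φ a * e₁ + h.add_two (r + 1) + φ (φ (φ^[r] a)) * h.add_two r

theorem map_eq_self (h : IsTwistedSeq φ a B) {ψ : R →+* R} (hψ : ∀ x, ψ (φ x) = φ (ψ x))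
    (ha : ψ a = a) (r : ℕ) : ψ (B r) = B r := by
  induction r using Nat.twoStepInduction with
  | zero => simp [h.zero]
  | one => simp [h.one]
  | more r ih₁ ih₂ => simp [h.add_two, hψ, ha, ih₁, ih₂]

theorem sub_eq_prod (h : IsTwistedSeq φ a B) {x : R} (hx : φ x * x + x + a = 0) (r : ℕ) :
    B (r + 1) * x - a * φ (B r) = ∏ i ∈ Finset.range (r + 1), φ^[i] x := by
  induction r with
  | zero => simp [h.zero, h.one]
  | succ r ih =>
    rw [Finset.prod_range_succ', Function.iterate_zero_apply]
    simp only [Function.iterate_succ_apply']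
    rw [← map_prod, ← ih, h.add_two]
    simp only [map_sub, map_mul]
    linear_combination -φ (B (r + 1)) * hx

theorem quadratic_eq_zero (h : IsTwistedSeq φ a B) {j : ℕ} {x : R}
    (hx : φ x * x + x + a = 0) (hfix : φ^[j + 1] x = x) :
    B (j + 1) * x ^ 2 + (-B (j + 2) - a * φ (B j)) * x + a * φ (B (j + 1)) = 0 := by
  have e₁ := h.sub_eq_prod hx (j + 1)
  rw [Finset.prod_range_succ, hfix, ← h.sub_eq_prod hx j] at e₁
  linear_combination -e₁

theorem map_sub_eq_self (h : IsTwistedSeq φ a B) {j : ℕ} {x : R}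
    (hx : φ x * x + x + a = 0) (hfix : φ^[j + 1] x = x) :
    φ (B (j + 1) * x - a * φ (B j)) = B (j + 1) * x - a * φ (B j) := by
  rw [h.sub_eq_prod hx, map_prod, Finset.prod_range_succ, Finset.prod_range_succ']
  simp only [← Function.iterate_succ_apply', hfix, Function.iterate_zero_apply]

theorem map_add_two (h : IsTwistedSeq φ a B) {j : ℕ} (ha : φ^[j + 1] a = a) :
    φ (B (j + 2)) = -φ (B (j + 1)) - a * φ (B j) := by
  rw [h.add_two' j, map_sub, map_neg, map_mul, ← Function.iterate_succ_apply' φ, ha]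

theorem map_trace (h : IsTwistedSeq φ a B) {j : ℕ} (ha : φ^[j + 1] a = a) :
    φ (B (j + 2) - a * φ (B j)) = B (j + 2) - a * φ (B j) := by
  rw [map_sub, map_mul]
  linear_combination h.map_add_two ha - h.add_two j

theorem middle_eq_zero (h : IsTwistedSeq φ a B) {j : ℕ} (ha : φ^[j + 1] a = a)
    (hF : B (j + 1) = 0) : -B (j + 2) - a * φ (B j) = 0 := by
  have e₁ := h.map_add_two ha
  have e₂ := h.add_two (j + 1)
  have e₃ := h.add_two' (j + 1)
  rw [hF] at e₁ e₂ e₃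
  simp only [map_zero, mul_zero, neg_zero] at e₁ e₂ e₃
  linear_combination -e₁ + e₂ - e₃

theorem root_of_quadratic [IsDomain R] (h : IsTwistedSeq φ a B) {j : ℕ} {x : R}
    (hF : φ (B (j + 1)) ≠ 0)
    (hx : B (j + 1) * x ^ 2 + (-B (j + 2) - a * φ (B j)) * x + a * φ (B (j + 1)) = 0)
    (hl : φ (B (j + 1) * x - a * φ (B j)) = B (j + 1) * x - a * φ (B j)) :
    φ x * x + x + a = 0 := by
  refine (mul_eq_zero.mp ?_).resolve_left hF
  simp only [map_sub, map_mul] at hl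
  linear_combination x * hl + hx + x * h.add_two j

end CommRing

end IsTwistedSeq

theorem prod_iterate_pow {K : Type*} [Field K] {p n k : ℕ} (hn : 0 < n) {b : K}
    (hb : b ^ p ^ n = b) :
    ∏ i ∈ Finset.range (n / n.gcd k), b ^ (p ^ k) ^ i =
      ∏ i ∈ Finset.range (n / n.gcd k), b ^ (p ^ n.gcd k) ^ i := by
  set d := n.gcd k with hd
  have hdpos : 0 < d := Nat.gcd_pos_of_pos_left _ hn
  set m := n / d with hm
  have hdn : d * m = n := Nat.mul_div_cancel' (Nat.gcd_dvd_left n k)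
  have hdk : d * (k / d) = k := Nat.mul_div_cancel' (Nat.gcd_dvd_right n k)
  have hcop : Nat.Coprime m (k / d) := Nat.coprime_div_gcd_div_gcd hdpos
  have hmpos : 0 < m := Nat.div_pos (Nat.gcd_le_left _ hn) hdpos
  have hper : Function.Periodic (fun i : ℕ => b ^ (p ^ d) ^ i) m := by
    intro i
    show b ^ (p ^ d) ^ (i + m) = b ^ (p ^ d) ^ i
    rw [pow_add, ← pow_mul p d m, hdn, mul_comm, pow_mul, hb]
  have hinj : Set.InjOn (fun i => k / d * i % m) (Finset.range m : Set ℕ) := by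
    intro i hi l hl hil
    simp only [Finset.coe_range, Set.mem_Iio] at hi hl
    have := Nat.ModEq.cancel_left_of_coprime hcop hil
    exact Nat.ModEq.eq_of_lt_of_lt this hi hl
  have himg : (Finset.range m).image (fun i => k / d * i % m) = Finset.range m := by
    apply Finset.eq_of_subset_of_card_le
    · intro i hi
      obtain ⟨l, -, rfl⟩ := Finset.mem_image.mp hi
      exact Finset.mem_range.mpr (Nat.mod_lt _ hmpos)
    · rw [Finset.card_image_of_injOn hinj]
  conv_rhs => rw [← himg, Finset.prod_image hinj]
  refine Finset.prod_congr rfl fun i _ => ?_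
  rw [hper.map_mod_nat (k / d * i), ← pow_mul, ← pow_mul, ← mul_assoc, hdk]

/-- Hilbert 90 for the `p ^ k`-power map on the field with `p ^ n` elements. -/
theorem exists_pow_eq_mul_of_prod_eq_one {K : Type*} [Field K] [IsAlgClosed K] {p n k : ℕ}
    (hp : 1 < p) (hn : 0 < n) {b : K} (hb : b ^ p ^ n = b)
    (hN : ∏ i ∈ Finset.range (n / n.gcd k), b ^ (p ^ k) ^ i = 1) :
    ∃ c : K, c ≠ 0 ∧ c ^ p ^ n = c ∧ c ^ p ^ k = b * c := by
  have hdpos : 0 < n.gcd k := Nat.gcd_pos_of_pos_left _ hn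
  have hpos : ∀ i, 1 ≤ p ^ i := fun i => Nat.one_le_pow _ _ (by omega)
  have hd1 : 0 < p ^ n.gcd k - 1 := Nat.sub_pos_of_lt (Nat.one_lt_pow hdpos.ne' hp)
  have hb0 : b ≠ 0 := by
    rintro rfl
    rw [prod_iterate_pow hn hb, Finset.prod_eq_zero (i := 0)] at hN
    · exact zero_ne_one hN
    · exact Finset.mem_range.mpr (Nat.div_pos (Nat.gcd_le_left _ hn) hdpos)
    · simp
  obtain ⟨c₀, hc₀⟩ := IsAlgClosed.exists_pow_nat_eq b hd1
  have hc₀0 : c₀ ≠ 0 := by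
    rintro rfl
    exact hb0 (by rw [← hc₀, zero_pow hd1.ne'])
  have hc₀n : c₀ ^ (p ^ n - 1) = 1 := by
    rw [prod_iterate_pow hn hb, Finset.prod_pow_eq_pow_sum, ← hc₀, ← pow_mul, mul_comm,
      Nat.geomSum_eq (Nat.one_lt_pow hdpos.ne' hp), ← pow_mul,
      Nat.mul_div_cancel' (Nat.gcd_dvd_left n k), Nat.div_mul_cancel] at hN
    · exact hN
    · exact Nat.pow_sub_one_dvd_pow_sub_one p (Nat.gcd_dvd_left n k)
  have hz : c₀ ^ ((p ^ n - 1 : ℕ) : ℤ) = 1 := by rw [zpow_natCast, hc₀n]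
  refine ⟨c₀ ^ Nat.gcdB (p ^ n - 1) (p ^ k - 1), zpow_ne_zero _ hc₀0, ?_, ?_⟩
  · rw [← Nat.sub_add_cancel (hpos n), pow_succ, ← zpow_natCast, ← zpow_mul, mul_comm _ (_ : ℤ),
      zpow_mul, hz, one_zpow, one_mul]
  · rw [← Nat.sub_add_cancel (hpos k), pow_succ, Nat.add_sub_cancel]
    congr 1
    have hg := Nat.gcd_eq_gcd_ab (p ^ n - 1) (p ^ k - 1)
    rw [Nat.pow_sub_one_gcd_pow_sub_one] at hg
    rw [← hc₀, ← zpow_natCast, ← zpow_natCast, hg, zpow_add₀ hc₀0, zpow_mul, hz, one_zpow, one_mul,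
      ← zpow_mul, mul_comm]

theorem pow_pow_gcd_eq_self {M : Type*} [Monoid M] {p n k : ℕ} {x : M} (hn : x ^ p ^ n = x)
    (hk : x ^ p ^ k = x) : x ^ p ^ n.gcd k = x := by
  have key : ∀ i, Function.IsPeriodicPt (fun y : M => y ^ p) i x ↔ x ^ p ^ i = x := by
    intro i
    rw [Function.IsPeriodicPt, Function.IsFixedPt, pow_iterate]
  exact (key _).mp (((key n).mpr hn).gcd ((key k).mpr hk))

theorem pow_pow_eq_self_of_dvd {M : Type*} [Monoid M] {p d n : ℕ} {x : M} (hx : x ^ p ^ d = x)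
    (h : d ∣ n) : x ^ p ^ n = x := by
  obtain ⟨e, rfl⟩ := h
  rw [pow_mul, ← congrFun (pow_iterate (M := M) (p ^ d) e) x]
  exact Function.iterate_fixed hx e

namespace IsTwistedSeq

variable {K : Type*} [Field K] {p n k j : ℕ} [ExpChar K p] {a : K} {B : ℕ → K}

theorem exists_third_root [IsAlgClosed K] (h : IsTwistedSeq (iterateFrobenius K p k) a B)
    (hp : 1 < p) (hn : 0 < n) (hj : n / n.gcd k = j + 1) (ha : a ≠ 0) (hF : B (j + 1) = 0)
    {x y : K} (hxy : x ≠ y) (hxn : x ^ p ^ n = x) (hyn : y ^ p ^ n = y)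
    (hx : x ^ p ^ k * x + x + a = 0) (hy : y ^ p ^ k * y + y + a = 0) :
    ∃ z, z ^ p ^ n = z ∧ z ^ p ^ k * z + z + a = 0 ∧ z ≠ x ∧ z ≠ y := by
  have hx0 : x ≠ 0 := by
    rintro rfl
    exact ha (by simpa using hx)
  have hy0 : y ≠ 0 := by
    rintro rfl
    exact ha (by simpa using hy)
  have hprod : ∀ u : K, u ^ p ^ k * u + u + a = 0 →
      ∏ i ∈ Finset.range (j + 1), u ^ (p ^ k) ^ i = -a * B j ^ p ^ k := by
    intro u hu
    have e := h.sub_eq_prod (x := u) (by rwa [iterateFrobenius_def]) j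
    rw [hF, iterateFrobenius_def, zero_mul, zero_sub, ← neg_mul] at e
    rw [e]
    refine Finset.prod_congr rfl fun i _ => ?_
    rw [coe_iterateFrobenius, ← Function.iterate_mul, ← coe_iterateFrobenius, iterateFrobenius_def,
      pow_mul]
  have hyprod : ∏ i ∈ Finset.range (j + 1), y ^ (p ^ k) ^ i ≠ 0 :=
    Finset.prod_ne_zero_iff.mpr fun i _ => pow_ne_zero _ hy0
  obtain ⟨c, hc0, hcn, hck⟩ := exists_pow_eq_mul_of_prod_eq_one (K := K) (k := k) (b := x / y) hp hn
    (by rw [div_pow, hxn, hyn])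
    (by
      simp only [div_pow, Finset.prod_div_distrib, hj]
      rw [div_eq_one_iff_eq hyprod, hprod x hx, hprod y hy])
  have hcy : y * c ^ p ^ k = x * c := by
    rw [hck]
    field_simp
  have hc1 : c + 1 ≠ 0 := by
    intro hc
    obtain rfl : c = -1 := eq_neg_of_add_eq_zero_left hc
    rw [← iterateFrobenius_def, map_neg, map_one] at hcy
    exact hxy (by linear_combination hcy)
  have hc1k : c ^ p ^ k + 1 ≠ 0 := by
    have := pow_ne_zero (p ^ k) hc1
    rwa [add_pow_expChar_pow, one_pow] at this
  refine ⟨(c * x + y) / (c + 1), ?_, ?_, ?_, ?_⟩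
  · rw [div_pow, add_pow_expChar_pow, add_pow_expChar_pow, mul_pow, hcn, hxn, hyn, one_pow]
  · rw [div_pow, add_pow_expChar_pow, add_pow_expChar_pow, mul_pow, one_pow]
    field_simp
    linear_combination (c ^ p ^ k * c + c) * hx + (c ^ p ^ k + 1) * hy +
      (x ^ p ^ k - y ^ p ^ k) * hcy
  · rw [Ne, div_eq_iff hc1]
    intro e
    exact hxy (by linear_combination -e)
  · rw [Ne, div_eq_iff hc1]
    intro e
    exact hxy (mul_left_cancel₀ hc0 (by linear_combination e))

theorem map_self_of_root {s : K} (h : IsTwistedSeq (iterateFrobenius K p k) a B)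
    (h2 : (2 : K) ≠ 0) (han : a ^ p ^ n = a) (ha : (iterateFrobenius K p k)^[j + 1] a = a)
    (hF : B (j + 1) ≠ 0) (hsn : s ^ p ^ n = s) (hsk : s ^ p ^ k = s)
    (hs : s ^ 2 = (-B (j + 2) - a * B j ^ p ^ k) ^ 2 - 4 * a * B (j + 1) ^ (p ^ k + 1)) :
    ((s - (-B (j + 2) - a * B j ^ p ^ k)) / (2 * B (j + 1))) ^ p ^ n =
        (s - (-B (j + 2) - a * B j ^ p ^ k)) / (2 * B (j + 1)) ∧
      ((s - (-B (j + 2) - a * B j ^ p ^ k)) / (2 * B (j + 1))) ^ p ^ k *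
        ((s - (-B (j + 2) - a * B j ^ p ^ k)) / (2 * B (j + 1))) +
          (s - (-B (j + 2) - a * B j ^ p ^ k)) / (2 * B (j + 1)) + a = 0 := by
  set φ := iterateFrobenius K p k with hφ
  have hφx : ∀ x, φ x = x ^ p ^ k := fun x => iterateFrobenius_def p k x
  have hBn : ∀ r, iterateFrobenius K p n (B r) = B r := fun r =>
    h.map_eq_self (fun x => by simp only [hφ, iterateFrobenius_def, ← pow_mul, mul_comm])
      (by rw [iterateFrobenius_def, han]) r
  constructor
  · rw [← iterateFrobenius_def] at han hsn ⊢
    simp only [map_div₀, map_sub, map_neg, map_mul, map_pow, map_ofNat, hBn, han, hsn]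
  · have hT := h.map_trace ha
    rw [pow_succ _ (p ^ k), ← hφx, ← hφx] at hs
    rw [← hφx] at hsk
    rw [← hφx, ← hφx]
    set x := (s - (-B (j + 2) - a * φ (B j))) / (2 * B (j + 1)) with hx
    have hl : 2 * (B (j + 1) * x - a * φ (B j)) = s + (B (j + 2) - a * φ (B j)) := by
      rw [hx]
      field_simp
      ring
    have h4 : (4 : K) ≠ 0 := by
      rw [show (4 : K) = 2 * 2 by norm_num]
      exact mul_ne_zero h2 h2
    refine h.root_of_quadratic (j := j) ((map_ne_zero φ).mpr hF) ?_ ?_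
    · refine mul_left_cancel₀ (mul_ne_zero h4 hF) ?_
      have e : 2 * B (j + 1) * x = s - (-B (j + 2) - a * φ (B j)) := by
        rw [hx]
        field_simp
      linear_combination
        (2 * B (j + 1) * x + s + (-B (j + 2) - a * φ (B j))) * e + hs
    · refine mul_left_cancel₀ h2 ?_
      have e := congrArg φ hl
      rw [map_mul, map_add, hT, hsk, map_ofNat] at e
      rw [e, hl]

end IsTwistedSeq

theorem isTwistedSeq_eval_A (p k : ℕ) [Fact p.Prime] (a : Kbar p) :
    IsTwistedSeq (iterateFrobenius (Kbar p) p k) a fun r => (A (p ^ k) (Kbar p) r).eval a where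
  zero := by simp [A]
  one := by simp [A]
  add_two r := by
    cases r with
    | zero => simp [A]
    | succ r => simp [A, iterateFrobenius_def, ← pow_mul, sq]

/-- `p` odd. For nonzero `a ∈ GF(Q)` and `E = G(a)² - 4·a·F(a)^{q+1} ∈ GF(p^d)`:
`P_a(X) = X^{q+1} + X + a` has exactly two zeros in `GF(Q)` iff `E` is a nonzero square in
`GF(p^d)`, i.e. `E^{(p^d-1)/2} = 1`; and in this case, for any `s ∈ GF(p^d)` with `s² = E`,
the two zeros are `(s - G(a))/(2·F(a))` and `(-s - G(a))/(2·F(a))`.  Here `F(a) = A_m(a)`,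
`G(a) = -A_{m+1}(a) - a·A_{m-1}(a)^q`, `q = p^k`, `Q = p^n`, `d = gcd(n,k)`, `m = n/d`. -/
theorem statement_17 (p k n d m q Q : ℕ) [Fact p.Prime] (hp : Odd p) (hk : 0 < k) (hn : 0 < n)
    (hd : d = Nat.gcd n k) (hm : m = n / d) (hq : q = p ^ k) (hQ : Q = p ^ n)
    (a : Kbar p) (haQ : a ^ Q = a) (ha0 : a ≠ 0)
    (Fa Ga E : Kbar p)
    (hFa : Fa = (A q (Kbar p) m).eval a)
    (hGa : Ga = -(A q (Kbar p) (m + 1)).eval a - a * ((A q (Kbar p) (m - 1)).eval a) ^ q)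
    (hE : E = Ga ^ 2 - 4 * a * Fa ^ (q + 1)) :
    ({x : Kbar p | x ^ Q = x ∧ x ^ (q + 1) + x + a = 0}.ncard = 2
        ↔ E ^ ((p ^ d - 1) / 2) = 1) ∧
    (E ^ ((p ^ d - 1) / 2) = 1 → ∀ s : Kbar p, s ^ p ^ d = s → s ^ 2 = E →
      {x : Kbar p | x ^ Q = x ∧ x ^ (q + 1) + x + a = 0}
        = {(s - Ga) / (2 * Fa), (-s - Ga) / (2 * Fa)}) := by
  subst hd hm hq hQ hFa hGa
  set φ := iterateFrobenius (Kbar p) p k with hφ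
  set B : ℕ → Kbar p := fun r => (A (p ^ k) (Kbar p) r).eval a with hB
  have hφx : ∀ x, φ x = x ^ p ^ k := fun x => iterateFrobenius_def p k x
  have h : IsTwistedSeq φ a B := isTwistedSeq_eval_A p k a
  have hdpos : 0 < n.gcd k := Nat.gcd_pos_of_pos_left _ hn
  obtain ⟨j, hj⟩ : ∃ j, n / n.gcd k = j + 1 :=
    Nat.exists_eq_add_one.mpr (Nat.div_pos (Nat.gcd_le_left _ hn) hdpos)
  have hp1 : 1 < p := (Fact.out : p.Prime).one_lt
  have hiter : ∀ i x, φ^[i] x = x ^ (p ^ k) ^ i := by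
    intro i x
    rw [← congrFun (pow_iterate (M := Kbar p) (p ^ k) i) x]
    exact congrArg (fun f => f^[i] x) (funext hφx)
  have hfix : ∀ x : Kbar p, x ^ p ^ n = x → φ^[j + 1] x = x := by
    intro x hx
    rw [hiter, ← pow_mul, ← hj]
    refine pow_pow_eq_self_of_dvd hx ⟨k / n.gcd k, ?_⟩
    rw [← Nat.mul_div_assoc _ (Nat.gcd_dvd_left n k), ← Nat.mul_div_assoc _ (Nat.gcd_dvd_right n k),
      mul_comm]
  have hB₂ : (A (p ^ k) (Kbar p) (n / n.gcd k + 1)).eval a = B (j + 2) := by rw [hj]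
  have hB₁ : (A (p ^ k) (Kbar p) (n / n.gcd k)).eval a = B (j + 1) := by rw [hj]
  have hB₀ : (A (p ^ k) (Kbar p) (n / n.gcd k - 1)).eval a = B j := by
    rw [hj, Nat.add_sub_cancel]
  rw [hB₀, hB₁, hB₂] at hE ⊢
  set F := B (j + 1) with hF
  set G := -B (j + 2) - a * B j ^ p ^ k with hG
  have h2 : (2 : Kbar p) ≠ 0 :=
    Ring.two_ne_zero (by rw [ringChar.eq (Kbar p) p]; rintro rfl; exact absurd hp (by decide))
  have hroots : ∀ x, x ^ (p ^ k + 1) + x + a = 0 ↔ x ^ p ^ k * x + x + a = 0 := by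
    intro x
    rw [pow_succ]
  have hquad : ∀ x, x ^ p ^ n = x ∧ x ^ (p ^ k + 1) + x + a = 0 →
      F * x ^ 2 + G * x + a * F ^ p ^ k = 0 := by
    rintro x ⟨hxn, hx⟩
    have := h.quadratic_eq_zero (j := j) (by rwa [hφx, ← hroots]) (hfix x hxn)
    rwa [hφx, hφx] at this
  have hF0 : E ≠ 0 → F ≠ 0 := by
    intro hE0 hF0
    have hG0 : G = 0 := by
      have := h.middle_eq_zero (hfix a haQ) hF0
      rwa [hφx] at this
    exact hE0 (by rw [hE, hF0, hG0]; simp)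
  have hpd : 1 < p ^ n.gcd k := Nat.one_lt_pow hdpos.ne' hp1
  have heven : 2 * ((p ^ n.gcd k - 1) / 2) = p ^ n.gcd k - 1 :=
    Nat.two_mul_div_two_of_even (hp.pow.tsub_odd odd_one)
  have hexp : (p ^ n.gcd k - 1) / 2 ≠ 0 := by
    intro e
    rw [e] at heven
    omega
  have hE0 : E ^ ((p ^ n.gcd k - 1) / 2) = 1 → E ≠ 0 := by
    rintro e rfl
    rw [zero_pow hexp] at e
    exact zero_ne_one e
  have hset : E ^ ((p ^ n.gcd k - 1) / 2) = 1 → ∀ s : Kbar p, s ^ p ^ n.gcd k = s → s ^ 2 = E →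
      {x : Kbar p | x ^ p ^ n = x ∧ x ^ (p ^ k + 1) + x + a = 0}
        = {(s - G) / (2 * F), (-s - G) / (2 * F)} := by
    intro hE1 s hsd hs
    have hF0 := hF0 (hE0 hE1)
    have hsn := pow_pow_eq_self_of_dvd hsd (Nat.gcd_dvd_left n k)
    have hsk := pow_pow_eq_self_of_dvd hsd (Nat.gcd_dvd_right n k)
    ext x
    simp only [Set.mem_ofPred_eq, Set.mem_insert_iff, Set.mem_singleton_iff]
    constructor
    · intro hx
      have hq := hquad x hx
      have : (2 * F * x - (s - G)) * (2 * F * x - (-s - G)) = 0 := by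
        rw [hE, pow_succ] at hs
        linear_combination 4 * F * hq - hs
      rw [eq_div_iff (mul_ne_zero h2 hF0), eq_div_iff (mul_ne_zero h2 hF0)]
      refine (mul_eq_zero.mp this).imp (fun e => ?_) fun e => ?_ <;> linear_combination e
    · rintro (rfl | rfl)
      · rw [hroots]
        exact h.map_self_of_root h2 haQ (hfix a haQ) hF0 hsn hsk (hs.trans hE)
      · rw [hroots]
        refine h.map_self_of_root h2 haQ (hfix a haQ) hF0 ?_ ?_ ((neg_sq s).trans (hs.trans hE))
        · rw [hp.pow.neg_pow, hsn]
        · rw [hp.pow.neg_pow, hsk]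
  refine ⟨⟨fun hcard => ?_, fun hE1 => ?_⟩, hset⟩
  · obtain ⟨x, y, hxy, hS⟩ := Set.ncard_eq_two.mp hcard
    have hmem : ∀ z, (z ^ p ^ n = z ∧ z ^ (p ^ k + 1) + z + a = 0) ↔ z = x ∨ z = y := by
      intro z
      have := Set.ext_iff.mp hS z
      simpa only [Set.mem_ofPred_eq, Set.mem_insert_iff, Set.mem_singleton_iff] using this
    obtain ⟨hxn, hx⟩ := (hmem x).mpr (.inl rfl)
    obtain ⟨hyn, hy⟩ := (hmem y).mpr (.inr rfl)
    have hF0 : F ≠ 0 := by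
      intro hF0
      obtain ⟨z, hzn, hz, hzx, hzy⟩ := h.exists_third_root hp1 hn hj ha0 hF0 hxy hxn hyn
        ((hroots x).mp hx) ((hroots y).mp hy)
      exact ((hmem z).mp ⟨hzn, (hroots z).mpr hz⟩).elim hzx hzy
    have hqx := hquad x ⟨hxn, hx⟩
    have hqy := hquad y ⟨hyn, hy⟩
    have hsum : F * (x + y) + G = 0 :=
      mul_left_cancel₀ (sub_ne_zero.mpr hxy) (by linear_combination hqx - hqy)
    have hs : (F * (x - y)) ^ 2 = E := by
      rw [hE, pow_succ _ (p ^ k)]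
      linear_combination 2 * F * hqx + 2 * F * hqy - (F * (x + y) + G) * hsum
    have hs0 : F * (x - y) ≠ 0 := mul_ne_zero hF0 (sub_ne_zero.mpr hxy)
    have hBn : ∀ r, iterateFrobenius (Kbar p) p n (B r) = B r := fun r =>
      h.map_eq_self (fun x => by simp only [hφ, iterateFrobenius_def, ← pow_mul, mul_comm])
        (by rw [iterateFrobenius_def, haQ]) r
    have hsn : (F * (x - y)) ^ p ^ n = F * (x - y) := by
      rw [← iterateFrobenius_def] at hxn hyn ⊢
      rw [map_mul, map_sub, hBn, hxn, hyn]
    have hsk : (F * (x - y)) ^ p ^ k = F * (x - y) := by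
      have hlx := h.map_sub_eq_self (by rwa [hφx, ← hroots]) (hfix x hxn)
      have hly := h.map_sub_eq_self (by rwa [hφx, ← hroots]) (hfix y hyn)
      rw [← hφx, show F * (x - y) = (F * x - a * φ (B j)) - (F * y - a * φ (B j)) by ring, map_sub,
        hlx, hly]
    have hsd := pow_pow_gcd_eq_self hsn hsk
    rw [← hs, ← pow_mul, heven]
    refine mul_right_cancel₀ hs0 ?_
    rw [← pow_succ, Nat.sub_add_cancel hpd.le, hsd, one_mul]
  · obtain ⟨s, hs⟩ := IsAlgClosed.exists_pow_nat_eq E two_pos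
    have hs0 : s ≠ 0 := by
      rintro rfl
      exact hE0 hE1 (by rw [← hs, zero_pow two_ne_zero])
    have hsd : s ^ p ^ n.gcd k = s := by
      rw [← Nat.sub_add_cancel hpd.le, pow_succ, ← heven, pow_mul, hs, hE1, one_mul]
    rw [hset hE1 s hsd hs]
    refine Set.ncard_pair fun e => ?_
    rw [div_left_inj' (mul_ne_zero h2 (hF0 (hE0 hE1)))] at e
    exact mul_ne_zero h2 hs0 (by linear_combination e)
end
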